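/- arXiv:2004.04609 — 3 statements merged into one kernel-verified Lean document; each statement's English description precedes it below -/
import Mathlib

section
/- Suppose ∫_{ℝ^N} ‖𝒦(φ)‖ dμ₀(φ) < ∞. Then for every r > 0 there exists a constant M = M(r) > 0 such that for all Y, Y' ∈ H with ‖Y‖ ≤ r and ‖Y'‖ ≤ r, the normalizing constants satisfy |L(Y) − L(Y')| ≤ M ‖Y − Y'‖. -/
open Real MeasureTheory

theorem abs_exp_neg_sub_exp_neg_le {a b : ℝ} (ha : 0 ≤ a) (hb : 0 ≤ b) :
    |Real.exp (-a) - Real.exp (-b)| ≤ |a - b| := by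
  wlog hab : a ≤ b generalizing a b
  · rw [abs_sub_comm, abs_sub_comm a b]
    exact this hb ha (le_of_not_ge hab)
  have h1 : Real.exp (-a) ≤ 1 := Real.exp_le_one_iff.2 (by linarith)
  have h2 : Real.exp (-b) = Real.exp (-a) * Real.exp (a - b) := by
    rw [← Real.exp_add]
    ring_nf
  have h3 := Real.add_one_le_exp (a - b)
  have h4 : Real.exp (-b) ≤ Real.exp (-a) := Real.exp_le_exp.2 (by linarith)
  rw [abs_of_nonneg (by linarith), abs_of_nonpos (by linarith), h2]
  nlinarith [Real.exp_pos (-a)]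

theorem abs_norm_sub_sq_sub_norm_sub_sq_le {E : Type*} [SeminormedAddCommGroup E] (x y z : E) :
    |‖x - z‖ ^ 2 - ‖y - z‖ ^ 2| ≤ (‖x‖ + ‖y‖ + 2 * ‖z‖) * ‖x - y‖ := by
  have h : |‖x - z‖ - ‖y - z‖| ≤ ‖x - y‖ := by
    simpa using abs_norm_sub_norm_le (x - z) (y - z)
  rw [sq_sub_sq, abs_mul, abs_of_nonneg (by positivity)]
  refine mul_le_mul ?_ h (abs_nonneg _) (by positivity)
  linarith [norm_sub_le x z, norm_sub_le y z]

/-- Local Lipschitz continuity of the Bayesian normalizing constant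
`L(Y) = ∫ exp(−‖Y − 𝒦(φ)‖²/(2γ²)) dμ₀(φ)`: if `∫ ‖𝒦(φ)‖ dμ₀(φ) < ∞`, then for every
`r > 0` there is `M > 0` such that `|L(Y) − L(Y')| ≤ M ‖Y − Y'‖` whenever
`‖Y‖ ≤ r` and `‖Y'‖ ≤ r`. -/
theorem normalizing_constant_locally_lipschitz
    {𝕜 : Type*} [RCLike 𝕜] {H : Type*} [NormedAddCommGroup H] [InnerProductSpace 𝕜 H]
    [CompleteSpace H] [MeasurableSpace H] [BorelSpace H] {N : ℕ} (γ : ℝ) (hγ : 0 < γ)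
    (μ₀ : Measure (EuclideanSpace ℝ (Fin N))) [IsProbabilityMeasure μ₀]
    (𝒦 : EuclideanSpace ℝ (Fin N) → H) (hK : Measurable 𝒦)
    (hint : Integrable (fun φ => ‖𝒦 φ‖) μ₀) (r : ℝ) (hr : 0 < r) :
    ∃ M : ℝ, 0 < M ∧ ∀ Y Y' : H, ‖Y‖ ≤ r → ‖Y'‖ ≤ r →
      |(∫ φ, Real.exp (-(‖Y - 𝒦 φ‖ ^ 2 / (2 * γ ^ 2))) ∂μ₀)
          - ∫ φ, Real.exp (-(‖Y' - 𝒦 φ‖ ^ 2 / (2 * γ ^ 2))) ∂μ₀|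
        ≤ M * ‖Y - Y'‖ := by
  have hγ2 : (0 : ℝ) < 2 * γ ^ 2 := by positivity
  have hexp (Y : H) :
      Integrable (fun φ => Real.exp (-(‖Y - 𝒦 φ‖ ^ 2 / (2 * γ ^ 2)))) μ₀ := by
    have hmeas : Measurable fun φ => ‖Y - 𝒦 φ‖ :=
      ((continuous_const.sub continuous_id).norm.measurable).comp hK
    refine Integrable.of_bound
      (((hmeas.pow_const 2).div_const _).neg.exp.aestronglyMeasurable) 1 (ae_of_all _ fun φ => ?_)
    rw [Real.norm_eq_abs, Real.abs_exp, Real.exp_le_one_iff, neg_nonpos]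
    positivity
  have hbound : Integrable (fun φ => (2 * r + 2 * ‖𝒦 φ‖) / (2 * γ ^ 2)) μ₀ :=
    ((integrable_const _).add (hint.const_mul 2)).div_const _
  refine ⟨(∫ φ, (2 * r + 2 * ‖𝒦 φ‖) / (2 * γ ^ 2) ∂μ₀) + 1, ?_, fun Y Y' hY hY' => ?_⟩
  · have : 0 ≤ ∫ φ, (2 * r + 2 * ‖𝒦 φ‖) / (2 * γ ^ 2) ∂μ₀ :=
      integral_nonneg fun φ => by positivity
    linarith
  rw [← integral_sub (hexp Y) (hexp Y'), ← Real.norm_eq_abs]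
  calc _ ≤ ∫ φ, (2 * r + 2 * ‖𝒦 φ‖) / (2 * γ ^ 2) * ‖Y - Y'‖ ∂μ₀ := by
        refine norm_integral_le_of_norm_le (hbound.mul_const _) (ae_of_all _ fun φ => ?_)
        rw [Real.norm_eq_abs]
        refine (abs_exp_neg_sub_exp_neg_le (by positivity) (by positivity)).trans ?_
        rw [← sub_div, abs_div, abs_of_pos hγ2, div_mul_eq_mul_div]
        gcongr
        refine (abs_norm_sub_sq_sub_norm_sub_sq_le Y Y' (𝒦 φ)).trans ?_
        gcongr
        linarith
    _ ≤ _ := by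
        rw [integral_mul_const]
        gcongr
        linarith
end

section
/- Suppose there is a constant C > 0 with ‖𝒦(φ)‖ ≤ C ‖φ‖ for all φ ∈ ℝ^N, and suppose ∫_{ℝ^N} ‖𝒦(φ)‖² dμ₀(φ) < ∞. Then the Bayesian inverse problem is well-posed in the Hellinger metric: for every r > 0 there exists M = M(r) > 0 such that for all data Y, Y' ∈ H with ‖Y‖ ≤ r and ‖Y'‖ ≤ r, the posterior measures μ^Y and μ^{Y'} satisfy d_H(μ^Y, μ^{Y'})² = (1/2) ∫_{ℝ^N} ( √( exp(−G(φ; Y)) / L(Y) ) − √( exp(−G(φ; Y')) / L(Y') ) )² dμ₀(φ) ≤ M² ‖Y − Y'‖². -/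
open Real MeasureTheory

/-- The squared `L²` distance between two normalized root densities is controlled by the squared
`L²` distance between the unnormalized ones. -/
theorem integral_sq_sqrt_div_integral_sub_le {α : Type*} [MeasurableSpace α] {μ : Measure α}
    {p q : α → ℝ} (hp : Integrable p μ) (hq : Integrable q μ) (hp0 : ∀ x, 0 ≤ p x)
    (hq0 : ∀ x, 0 ≤ q x) (hP : 0 < ∫ x, p x ∂μ) (hQ : 0 < ∫ x, q x ∂μ) :
    ∫ x, (√(p x / ∫ y, p y ∂μ) - √(q x / ∫ y, q y ∂μ)) ^ 2 ∂μ
      ≤ (∫ x, (√(p x) - √(q x)) ^ 2 ∂μ) / (√(∫ x, p x ∂μ) * √(∫ x, q x ∂μ)) := by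
  have hpq : Integrable (fun x => √(p x) * √(q x)) μ := by
    refine (hp.add hq).mono'
      ((continuous_sqrt.comp_aestronglyMeasurable hp.1).mul
        (continuous_sqrt.comp_aestronglyMeasurable hq.1)) (ae_of_all _ fun x => ?_)
    rw [Real.norm_of_nonneg (by positivity)]
    simp only [Pi.add_apply]
    nlinarith [sq_nonneg (√(p x) - √(q x)), sq_sqrt (hp0 x), sq_sqrt (hq0 x), hp0 x, hq0 x]
  set s := √(∫ x, p x ∂μ) with hs
  set t := √(∫ x, q x ∂μ) with ht
  have hs0 : 0 < s := sqrt_pos.2 hP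
  have ht0 : 0 < t := sqrt_pos.2 hQ
  have hs2 : ∫ x, p x ∂μ = s ^ 2 := (sq_sqrt hP.le).symm
  have ht2 : ∫ x, q x ∂μ = t ^ 2 := (sq_sqrt hQ.le).symm
  have expand : ∀ a b : ℝ, ∫ x, (a * √(p x) - b * √(q x)) ^ 2 ∂μ
      = a ^ 2 * s ^ 2 + b ^ 2 * t ^ 2 - 2 * a * b * ∫ x, √(p x) * √(q x) ∂μ := by
    intro a b
    rw [← hs2, ← ht2, ← integral_const_mul, ← integral_const_mul, ← integral_const_mul,
      ← integral_add (hp.const_mul _) (hq.const_mul _),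
      ← integral_sub (f := fun x => a ^ 2 * p x + b ^ 2 * q x)
        ((hp.const_mul _).add (hq.const_mul _)) (hpq.const_mul _)]
    refine integral_congr_ae (ae_of_all _ fun x => ?_)
    linear_combination a ^ 2 * sq_sqrt (hp0 x) + b ^ 2 * sq_sqrt (hq0 x)
  have hl : ∫ x, (√(p x / ∫ y, p y ∂μ) - √(q x / ∫ y, q y ∂μ)) ^ 2 ∂μ
      = ∫ x, (s⁻¹ * √(p x) - t⁻¹ * √(q x)) ^ 2 ∂μ := by
    refine integral_congr_ae (ae_of_all _ fun x => ?_)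
    simp only [sqrt_div (hp0 x), sqrt_div (hq0 x), ← hs, ← ht]
    ring
  have hr := expand 1 1
  simp only [one_mul] at hr
  rw [hl, expand, hr, le_div_iff₀ (by positivity)]
  have : (s⁻¹ ^ 2 * s ^ 2 + t⁻¹ ^ 2 * t ^ 2 - 2 * s⁻¹ * t⁻¹ * ∫ x, √(p x) * √(q x) ∂μ) * (s * t)
      = 2 * (s * t) - 2 * ∫ x, √(p x) * √(q x) ∂μ := by
    field_simp
    ring
  rw [this]
  nlinarith [sq_nonneg (s - t)]

theorem abs_exp_neg_sub_exp_neg_le_s10 {u v : ℝ} (hu : 0 ≤ u) (hv : 0 ≤ v) :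
    |exp (-u) - exp (-v)| ≤ |u - v| := by
  wlog h : u ≤ v generalizing u v
  · rw [abs_sub_comm, abs_sub_comm u]
    exact this hv hu (le_of_not_ge h)
  rw [abs_of_nonneg (sub_nonneg.2 (exp_le_exp.2 (neg_le_neg h))), abs_sub_comm,
    abs_of_nonneg (sub_nonneg.2 h)]
  have h1 : exp (-v) = exp (-u) * exp (-(v - u)) := by rw [← exp_add]; ring_nf
  have h2 : 1 - (v - u) ≤ exp (-(v - u)) := by linarith [add_one_le_exp (-(v - u))]
  have h3 : exp (-u) ≤ 1 := exp_le_one_iff.2 (by linarith)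
  rw [h1]
  nlinarith [exp_pos (-u)]

theorem sq_sqrt_exp_neg_norm_sq_sub_le {H : Type*} [SeminormedAddCommGroup H] {c r : ℝ}
    (hc : 0 < c) {y y' k : H} (hy : ‖y‖ ≤ r) (hy' : ‖y'‖ ≤ r) :
    (√(exp (-(‖y - k‖ ^ 2 / c))) - √(exp (-(‖y' - k‖ ^ 2 / c)))) ^ 2
      ≤ 2 / c ^ 2 * (r ^ 2 + ‖k‖ ^ 2) * ‖y - y'‖ ^ 2 := by
  have key : |√(exp (-(‖y - k‖ ^ 2 / c))) - √(exp (-(‖y' - k‖ ^ 2 / c)))|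
      ≤ (r + ‖k‖) * ‖y - y'‖ / c := by
    rw [← exp_half, ← exp_half, neg_div, neg_div]
    refine (abs_exp_neg_sub_exp_neg_le_s10 (by positivity) (by positivity)).trans ?_
    have h1 : ‖y - k‖ ^ 2 / c / 2 - ‖y' - k‖ ^ 2 / c / 2
        = (‖y - k‖ + ‖y' - k‖) / 2 * (‖y - k‖ - ‖y' - k‖) / c := by ring
    have h2 : |‖y - k‖ - ‖y' - k‖| ≤ ‖y - y'‖ := by
      simpa using abs_norm_sub_norm_le (y - k) (y' - k)
    have h3 : (‖y - k‖ + ‖y' - k‖) / 2 ≤ r + ‖k‖ := by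
      linarith [norm_sub_le y k, norm_sub_le y' k]
    rw [h1, abs_div, abs_mul, abs_of_pos hc, abs_of_nonneg (by positivity)]
    have := (norm_nonneg y).trans hy
    gcongr
  calc _ ≤ ((r + ‖k‖) * ‖y - y'‖ / c) ^ 2 := sq_le_sq' (neg_le_of_abs_le key) (le_of_abs_le key)
    _ = (r + ‖k‖) ^ 2 / c ^ 2 * ‖y - y'‖ ^ 2 := by ring
    _ ≤ (2 * (r ^ 2 + ‖k‖ ^ 2)) / c ^ 2 * ‖y - y'‖ ^ 2 := by gcongr; exact add_sq_le
    _ = _ := by ring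

/-- Well-posedness of the Bayesian inverse source problem in the Hellinger metric:
under a linear bound on the forward operator and square integrability of `‖𝒦(·)‖`,
for every `r > 0` there is `M > 0` such that for all data `‖Y‖ ≤ r`, `‖Y'‖ ≤ r`,
`d_H(μ^Y, μ^{Y'})² = (1/2) ∫ (√(exp(−G(φ;Y))/L(Y)) − √(exp(−G(φ;Y'))/L(Y')))² dμ₀
  ≤ M² ‖Y − Y'‖²`,
where `G(φ; Y) = ‖Y − 𝒦(φ)‖²/(2γ²)` and `L(Y) = ∫ exp(−G(φ;Y)) dμ₀(φ)`. -/
theorem bayesian_wellposed_hellinger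
    {𝕜 : Type*} [RCLike 𝕜] {H : Type*} [NormedAddCommGroup H] [InnerProductSpace 𝕜 H]
    [CompleteSpace H] [MeasurableSpace H] [BorelSpace H] {N : ℕ} (γ : ℝ) (hγ : 0 < γ)
    (μ₀ : Measure (EuclideanSpace ℝ (Fin N))) [IsProbabilityMeasure μ₀]
    (𝒦 : EuclideanSpace ℝ (Fin N) → H) (hK : Measurable 𝒦)
    (C : ℝ) (hC : 0 < C) (hbound : ∀ φ, ‖𝒦 φ‖ ≤ C * ‖φ‖)
    (hint : Integrable (fun φ => ‖𝒦 φ‖ ^ 2) μ₀) (r : ℝ) (hr : 0 < r) :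
    ∃ M : ℝ, 0 < M ∧ ∀ Y Y' : H, ‖Y‖ ≤ r → ‖Y'‖ ≤ r →
      (1 / 2) * (∫ φ, (Real.sqrt (Real.exp (-(‖Y - 𝒦 φ‖ ^ 2 / (2 * γ ^ 2)))
              / (∫ ψ, Real.exp (-(‖Y - 𝒦 ψ‖ ^ 2 / (2 * γ ^ 2))) ∂μ₀))
          - Real.sqrt (Real.exp (-(‖Y' - 𝒦 φ‖ ^ 2 / (2 * γ ^ 2)))
              / (∫ ψ, Real.exp (-(‖Y' - 𝒦 ψ‖ ^ 2 / (2 * γ ^ 2))) ∂μ₀))) ^ 2 ∂μ₀)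
        ≤ M ^ 2 * ‖Y - Y'‖ ^ 2 := by
  set c : ℝ := 2 * γ ^ 2
  have hc : 0 < c := by positivity
  have exp_integrable : ∀ g : EuclideanSpace ℝ (Fin N) → ℝ, Measurable g → (∀ φ, 0 ≤ g φ) →
      Integrable (fun φ => exp (-g φ)) μ₀ := fun g hg hg0 =>
    (integrable_const (1 : ℝ)).mono' hg.neg.exp.aestronglyMeasurable (ae_of_all _ fun φ => by
      rw [Real.norm_of_nonneg (exp_pos _).le]
      exact exp_le_one_iff.2 (neg_nonpos.2 (hg0 φ)))
  have hlik : ∀ Y : H, Integrable (fun φ => exp (-(‖Y - 𝒦 φ‖ ^ 2 / c))) μ₀ := fun Y =>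
    exp_integrable _ (((((continuous_const.sub continuous_id).norm.measurable.comp hK :
      Measurable fun φ => ‖Y - 𝒦 φ‖)).pow_const 2).div_const c) fun φ => by positivity
  have hlow : Integrable (fun φ => exp (-(2 * (r ^ 2 + ‖𝒦 φ‖ ^ 2) / c))) μ₀ :=
    exp_integrable _ ((((hK.norm.pow_const 2).const_add _).const_mul _).div_const _)
      fun φ => by positivity
  set ℓ := ∫ φ, exp (-(2 * (r ^ 2 + ‖𝒦 φ‖ ^ 2) / c)) ∂μ₀
  have hℓ : 0 < ℓ := integral_exp_pos hlow
  have hL : ∀ Y : H, ‖Y‖ ≤ r → ℓ ≤ ∫ φ, exp (-(‖Y - 𝒦 φ‖ ^ 2 / c)) ∂μ₀ := by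
    refine fun Y hY => integral_mono hlow (hlik Y) fun φ => ?_
    have : ‖Y - 𝒦 φ‖ ^ 2 ≤ 2 * (r ^ 2 + ‖𝒦 φ‖ ^ 2) :=
      calc _ ≤ (r + ‖𝒦 φ‖) ^ 2 := by gcongr; linarith [norm_sub_le Y (𝒦 φ)]
        _ ≤ _ := add_sq_le
    dsimp only
    gcongr
  set A := 2 / c ^ 2 * (r ^ 2 + ∫ φ, ‖𝒦 φ‖ ^ 2 ∂μ₀)
  have hA : 0 < A := by
    have : 0 ≤ ∫ φ, ‖𝒦 φ‖ ^ 2 ∂μ₀ := integral_nonneg fun φ => by positivity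
    positivity
  refine ⟨√(A / (2 * ℓ)), by positivity, fun Y Y' hY hY' => ?_⟩
  have hnum : ∫ φ, (√(exp (-(‖Y - 𝒦 φ‖ ^ 2 / c))) - √(exp (-(‖Y' - 𝒦 φ‖ ^ 2 / c)))) ^ 2 ∂μ₀
      ≤ A * ‖Y - Y'‖ ^ 2 := by
    refine (integral_mono_of_nonneg (ae_of_all _ fun φ => sq_nonneg _)
      ((((integrable_const (r ^ 2)).add hint).const_mul (2 / c ^ 2)).mul_const (‖Y - Y'‖ ^ 2))
      (ae_of_all _ fun φ => sq_sqrt_exp_neg_norm_sq_sub_le hc hY hY')).trans_eq ?_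
    simp only [Pi.add_apply]
    rw [integral_mul_const, integral_const_mul, integral_add (integrable_const _) hint]
    simp [A]
  have hden : ℓ ≤ √(∫ φ, exp (-(‖Y - 𝒦 φ‖ ^ 2 / c)) ∂μ₀)
      * √(∫ φ, exp (-(‖Y' - 𝒦 φ‖ ^ 2 / c)) ∂μ₀) :=
    calc ℓ = √ℓ * √ℓ := (mul_self_sqrt hℓ.le).symm
      _ ≤ _ := mul_le_mul (sqrt_le_sqrt (hL Y hY)) (sqrt_le_sqrt (hL Y' hY')) (by positivity)
        (by positivity)
  rw [sq_sqrt (by positivity)]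
  calc _ ≤ 1 / 2 * ((A * ‖Y - Y'‖ ^ 2) / ℓ) := by
        gcongr
        refine (integral_sq_sqrt_div_integral_sub_le (hlik Y) (hlik Y') (fun _ => (exp_pos _).le)
          (fun _ => (exp_pos _).le) (hℓ.trans_le (hL Y hY)) (hℓ.trans_le (hL Y' hY'))).trans ?_
        exact div_le_div₀ (by positivity) hnum hℓ hden
    _ = A / (2 * ℓ) * ‖Y - Y'‖ ^ 2 := by field_simp
end

section
/- Suppose there is a constant C > 0 with ‖𝒦(φ)‖ ≤ C ‖φ‖ for all φ ∈ ℝ^N, and suppose ∫_{ℝ^N} ‖𝒦(φ)‖² dμ₀(φ) < ∞. Then the Bayesian inverse problem is well-posed in the total variation metric: for every r > 0 there exists M = M(r) > 0 such that for all data Y, Y' ∈ H with ‖Y‖ ≤ r and ‖Y'‖ ≤ r, the posterior measures μ^Y and μ^{Y'} satisfy d_{TV}(μ^Y, μ^{Y'}) = (1/2) ∫_{ℝ^N} | exp(−G(φ; Y)) / L(Y) − exp(−G(φ; Y')) / L(Y') | dμ₀(φ) ≤ M ‖Y − Y'‖. -/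
open Real MeasureTheory

/-- The `L¹` distance between two normalized densities is controlled by that of the
unnormalized ones. -/
theorem integral_abs_div_integral_sub_le {α : Type*} [MeasurableSpace α] {μ : Measure α}
    {a b : α → ℝ} (ha : Integrable a μ) (hb : Integrable b μ) (hb0 : ∀ x, 0 ≤ b x)
    (hA : 0 < ∫ x, a x ∂μ) (hB : 0 < ∫ x, b x ∂μ) :
    ∫ x, |a x / (∫ y, a y ∂μ) - b x / (∫ y, b y ∂μ)| ∂μ
      ≤ 2 * (∫ x, |a x - b x| ∂μ) / ∫ y, a y ∂μ := by
  set A := ∫ x, a x ∂μ with hAdef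
  set B := ∫ x, b x ∂μ with hBdef
  set D := ∫ x, |a x - b x| ∂μ with hD
  have hAB : |B - A| ≤ D := by
    rw [abs_sub_comm, hAdef, hBdef, ← integral_sub ha hb]
    exact abs_integral_le_integral_abs
  have hi : Integrable (fun x => |a x - b x|) μ := (ha.sub hb).abs
  have hpt : ∀ x, |a x / A - b x / B| ≤ |a x - b x| / A + b x * (D / (A * B)) := by
    intro x
    have h : a x / A - b x / B = (a x - b x) / A + b x * ((B - A) / (A * B)) := by
      field_simp
      ring
    rw [h]
    refine (abs_add_le _ _).trans ?_
    rw [abs_div, abs_mul, abs_div, abs_of_pos hA, abs_of_nonneg (hb0 x),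
      abs_of_pos (mul_pos hA hB)]
    have := hb0 x
    gcongr
  calc ∫ x, |a x / A - b x / B| ∂μ
      ≤ ∫ x, (|a x - b x| / A + b x * (D / (A * B))) ∂μ :=
        integral_mono ((ha.div_const _).sub (hb.div_const _)).abs
          ((hi.div_const _).add (hb.mul_const _)) hpt
    _ = D / A + B * (D / (A * B)) := by
        rw [integral_add (hi.div_const _) (hb.mul_const _), integral_div, integral_mul_const]
    _ = 2 * D / A := by
        field_simp
        ring

theorem abs_exp_neg_sub_exp_neg_le_s11 {x y : ℝ} (hx : 0 ≤ x) (hy : 0 ≤ y) :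
    |exp (-x) - exp (-y)| ≤ |x - y| := by
  wlog hxy : x ≤ y generalizing x y
  · rw [abs_sub_comm, abs_sub_comm x]
    exact this hy hx (le_of_not_ge hxy)
  have h1 : exp (-x) ≤ 1 := exp_le_one_iff.mpr (by linarith)
  have h2 : exp (-y) = exp (-x) * exp (x - y) := by
    rw [← exp_add]
    ring_nf
  have h3 := add_one_le_exp (x - y)
  have h4 : exp (-y) ≤ exp (-x) := exp_le_exp.mpr (by linarith)
  rw [abs_of_nonneg (by linarith), abs_of_nonpos (by linarith), h2]
  nlinarith [exp_pos (-x)]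

/-- Well-posedness of the Bayesian inverse source problem in the total variation metric:
under a linear bound on the forward operator and square integrability of `‖𝒦(·)‖`,
for every `r > 0` there is `M > 0` such that for all data `‖Y‖ ≤ r`, `‖Y'‖ ≤ r`,
`d_{TV}(μ^Y, μ^{Y'}) = (1/2) ∫ |exp(−G(φ;Y))/L(Y) − exp(−G(φ;Y'))/L(Y')| dμ₀
  ≤ M ‖Y − Y'‖`,
where `G(φ; Y) = ‖Y − 𝒦(φ)‖²/(2γ²)` and `L(Y) = ∫ exp(−G(φ;Y)) dμ₀(φ)`. -/
theorem bayesian_wellposed_tv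
    {𝕜 : Type*} [RCLike 𝕜] {H : Type*} [NormedAddCommGroup H] [InnerProductSpace 𝕜 H]
    [CompleteSpace H] [MeasurableSpace H] [BorelSpace H] {N : ℕ} (γ : ℝ) (hγ : 0 < γ)
    (μ₀ : Measure (EuclideanSpace ℝ (Fin N))) [IsProbabilityMeasure μ₀]
    (𝒦 : EuclideanSpace ℝ (Fin N) → H) (hK : Measurable 𝒦)
    (C : ℝ) (hC : 0 < C) (hbound : ∀ φ, ‖𝒦 φ‖ ≤ C * ‖φ‖)
    (hint : Integrable (fun φ => ‖𝒦 φ‖ ^ 2) μ₀) (r : ℝ) (hr : 0 < r) :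
    ∃ M : ℝ, 0 < M ∧ ∀ Y Y' : H, ‖Y‖ ≤ r → ‖Y'‖ ≤ r →
      (1 / 2) * (∫ φ, |Real.exp (-(‖Y - 𝒦 φ‖ ^ 2 / (2 * γ ^ 2)))
              / (∫ ψ, Real.exp (-(‖Y - 𝒦 ψ‖ ^ 2 / (2 * γ ^ 2))) ∂μ₀)
          - Real.exp (-(‖Y' - 𝒦 φ‖ ^ 2 / (2 * γ ^ 2)))
              / (∫ ψ, Real.exp (-(‖Y' - 𝒦 ψ‖ ^ 2 / (2 * γ ^ 2))) ∂μ₀)| ∂μ₀)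
        ≤ M * ‖Y - Y'‖ := by
  have hKn : Measurable fun φ => ‖𝒦 φ‖ := hK.norm
  have hexp_int : ∀ f : EuclideanSpace ℝ (Fin N) → ℝ, Measurable f →
      Integrable (fun φ => exp (-(f φ ^ 2 / (2 * γ ^ 2)))) μ₀ := by
    intro f hf
    refine Integrable.of_bound (C := 1) (by fun_prop) (ae_of_all _ fun φ => ?_)
    rw [norm_eq_abs, abs_of_pos (exp_pos _), exp_le_one_iff, neg_nonpos]
    positivity
  have hdist : ∀ Y : H, Measurable fun φ => ‖Y - 𝒦 φ‖ := fun Y =>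
    (continuous_const.sub continuous_id).norm.measurable.comp hK
  set c := ∫ φ, exp (-((r + ‖𝒦 φ‖) ^ 2 / (2 * γ ^ 2))) ∂μ₀ with hcdef
  have hc : 0 < c := integral_exp_pos (hexp_int _ (hKn.const_add r))
  set I := ∫ φ, (r + 1 + ‖𝒦 φ‖ ^ 2) / γ ^ 2 ∂μ₀ with hIdef
  have hIint : Integrable (fun φ => (r + 1 + ‖𝒦 φ‖ ^ 2) / γ ^ 2) μ₀ :=
    ((integrable_const (r + 1)).add hint).div_const _
  have hI : 0 ≤ I := integral_nonneg fun φ => by positivity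
  have hnorm : ∀ Y : H, ‖Y‖ ≤ r → ∀ φ, ‖Y - 𝒦 φ‖ ≤ r + ‖𝒦 φ‖ := fun Y hY φ =>
    (norm_sub_le _ _).trans (by gcongr)
  refine ⟨I / c + 1, by positivity, fun Y Y' hY hY' => ?_⟩
  have hYi := hexp_int _ (hdist Y)
  have hYi' := hexp_int _ (hdist Y')
  have hcA : c ≤ ∫ ψ, exp (-(‖Y - 𝒦 ψ‖ ^ 2 / (2 * γ ^ 2))) ∂μ₀ := by
    refine integral_mono (hexp_int _ (hKn.const_add r)) hYi fun φ => ?_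
    have := hnorm Y hY φ
    dsimp only
    gcongr
  have hD : ∫ φ, |exp (-(‖Y - 𝒦 φ‖ ^ 2 / (2 * γ ^ 2)))
      - exp (-(‖Y' - 𝒦 φ‖ ^ 2 / (2 * γ ^ 2)))| ∂μ₀ ≤ I * ‖Y - Y'‖ := by
    rw [hIdef, ← integral_mul_const]
    refine integral_mono (hYi.sub hYi').abs (hIint.mul_const _) fun φ => ?_
    refine (abs_exp_neg_sub_exp_neg_le_s11 (by positivity) (by positivity)).trans ?_
    have h1 := hnorm Y hY φ
    have h2 := hnorm Y' hY' φ
    have h3 : |‖Y - 𝒦 φ‖ - ‖Y' - 𝒦 φ‖| ≤ ‖Y - Y'‖ := by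
      simpa using abs_norm_sub_norm_le (Y - 𝒦 φ) (Y' - 𝒦 φ)
    have h4 : ‖Y - 𝒦 φ‖ + ‖Y' - 𝒦 φ‖ ≤ 2 * (r + 1 + ‖𝒦 φ‖ ^ 2) := by
      nlinarith [sq_nonneg (‖𝒦 φ‖ - 1)]
    calc |‖Y - 𝒦 φ‖ ^ 2 / (2 * γ ^ 2) - ‖Y' - 𝒦 φ‖ ^ 2 / (2 * γ ^ 2)|
        = (‖Y - 𝒦 φ‖ + ‖Y' - 𝒦 φ‖) * |‖Y - 𝒦 φ‖ - ‖Y' - 𝒦 φ‖| / (2 * γ ^ 2) := by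
          rw [← sub_div, abs_div, sq_sub_sq, abs_mul,
            abs_of_nonneg (a := ‖Y - 𝒦 φ‖ + ‖Y' - 𝒦 φ‖) (by positivity),
            abs_of_pos (a := 2 * γ ^ 2) (by positivity)]
      _ ≤ 2 * (r + 1 + ‖𝒦 φ‖ ^ 2) * ‖Y - Y'‖ / (2 * γ ^ 2) := by gcongr
      _ = (r + 1 + ‖𝒦 φ‖ ^ 2) / γ ^ 2 * ‖Y - Y'‖ := by
          field_simp
  have key := integral_abs_div_integral_sub_le hYi hYi' (fun _ => (exp_pos _).le)
    (integral_exp_pos hYi) (integral_exp_pos hYi')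
  calc _ ≤ 1 / 2 * (2 * (I * ‖Y - Y'‖) / c) := by
        refine mul_le_mul_of_nonneg_left (key.trans ?_) (by norm_num)
        gcongr
    _ = I / c * ‖Y - Y'‖ := by ring
    _ ≤ (I / c + 1) * ‖Y - Y'‖ := by
        gcongr
        linarith
end
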